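/- arXiv:2504.14308 — 2 statements merged into one kernel-verified Lean document; each statement's English description precedes it below -/
import Mathlib

section
/- Let A = (a_{ij}) ∈ ℝ^{n×n} be an SDD₁ matrix with all diagonal entries positive, let D = diag(d₁,…,d_n) with 0 ≤ d_i ≤ 1 for all i, and set B = I − D + DA = (b_{ij}). Then: (1) b_{ii} > 0 for all i; (2) B is an SDD₁ matrix; (3) N₁(B) ⊆ N₁(A) and N₂(A) ⊆ N₂(B), where N₁(·), N₂(·) denote the non-diagonally-dominant and diagonally-dominant index sets of the respective matrix; (4) B is an N₂(A)-SDD₁ matrix, i.e., b_{ii} − R_i^{N∖N₂(A)}(B) − Q_i^{N₂(A)}(B) > 0 for all i ∈ N. -/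
open Finset Matrix
open scoped BigOperators Classical

/-- Row sum of absolute values of off-diagonal entries: `R_i(B)`, real version. -/
noncomputable def rowRR {m : Type*} [Fintype m] [DecidableEq m] (B : Matrix m m ℝ) (i : m) : ℝ :=
  ∑ j ∈ Finset.univ.erase i, |B i j|

/-- Partial row sum over an index set `S`: `R_i^S(B)`, real version. -/
noncomputable def rowRSR {m : Type*} [Fintype m] [DecidableEq m] (B : Matrix m m ℝ)
    (S : Finset m) (i : m) : ℝ :=
  ∑ j ∈ S.erase i, |B i j|

/-- Weighted partial row sum over an index set `S`: `Q_i^S(B)`, real version. -/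
noncomputable def rowQSR {m : Type*} [Fintype m] [DecidableEq m] (B : Matrix m m ℝ)
    (S : Finset m) (i : m) : ℝ :=
  ∑ j ∈ S.erase i, |B i j| * rowRR B j / |B j j|

/-- The non-diagonally dominant index set `N₁(B)`, real version. -/
noncomputable def setN1R {m : Type*} [Fintype m] [DecidableEq m] (B : Matrix m m ℝ) : Finset m :=
  Finset.univ.filter fun i => |B i i| ≤ rowRR B i

/-- The diagonally dominant index set `N₂(B)`, real version. -/
noncomputable def setN2R {m : Type*} [Fintype m] [DecidableEq m] (B : Matrix m m ℝ) : Finset m :=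
  Finset.univ.filter fun i => rowRR B i < |B i i|

/-- `P_i(B) = R_i^{N₁}(B) + Q_i^{N₂}(B)`, real version. -/
noncomputable def PfunR {m : Type*} [Fintype m] [DecidableEq m] (B : Matrix m m ℝ) (i : m) : ℝ :=
  rowRSR B (setN1R B) i + rowQSR B (setN2R B) i

/-- `SDD₁` matrix, real version. -/
def IsSDD1R {m : Type*} [Fintype m] [DecidableEq m] (B : Matrix m m ℝ) : Prop :=
  ∀ i, PfunR B i < |B i i|

theorem setN1R_eq_compl {m : Type*} [Fintype m] [DecidableEq m] (M : Matrix m m ℝ) :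
    setN1R M = (setN2R M)ᶜ := by
  ext i
  simp [setN1R, setN2R]

theorem rowRR_nonneg {m : Type*} [Fintype m] [DecidableEq m] (M : Matrix m m ℝ) (i : m) :
    0 ≤ rowRR M i :=
  Finset.sum_nonneg fun _ _ => abs_nonneg _

/-- The split row sum `R_i^{Sᶜ} + Q_i^S` is a single weighted off-diagonal row sum. -/
theorem rowRSR_compl_add_rowQSR {m : Type*} [Fintype m] [DecidableEq m] (M : Matrix m m ℝ)
    (S : Finset m) (i : m) :
    rowRSR M Sᶜ i + rowQSR M S i =
      ∑ j ∈ Finset.univ.erase i, |M i j| * if j ∈ S then rowRR M j / |M j j| else 1 := by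
  have h₁ : Sᶜ.erase i = (Finset.univ.erase i).filter (· ∉ S) := by
    ext j
    simp
  have h₂ : S.erase i = (Finset.univ.erase i).filter (· ∈ S) := by
    ext j
    simp
  rw [rowRSR, rowQSR, h₁, h₂, Finset.sum_filter, Finset.sum_filter, ← Finset.sum_add_distrib]
  refine Finset.sum_congr rfl fun j _ => ?_
  by_cases hj : j ∈ S <;> simp [hj, mul_div_assoc]

/-- Enlarging `S` inside the diagonally dominant set decreases `R_i^{Sᶜ} + Q_i^S`. -/
theorem rowRSR_compl_add_rowQSR_anti {m : Type*} [Fintype m] [DecidableEq m] (M : Matrix m m ℝ)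
    {S T : Finset m} (hST : S ⊆ T) (hT : T ⊆ setN2R M) (i : m) :
    rowRSR M Tᶜ i + rowQSR M T i ≤ rowRSR M Sᶜ i + rowQSR M S i := by
  rw [rowRSR_compl_add_rowQSR, rowRSR_compl_add_rowQSR]
  refine Finset.sum_le_sum fun j _ => mul_le_mul_of_nonneg_left ?_ (abs_nonneg _)
  by_cases hS : j ∈ S
  · simp [hS, hST hS]
  · by_cases hjT : j ∈ T
    · have hj : rowRR M j < |M j j| := by simpa [setN2R] using hT hjT
      simpa [hS, hjT] using div_le_one_of_le₀ hj.le (abs_nonneg _)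
    · simp [hS, hjT]

/-- If `A` is a real `SDD₁` matrix with positive diagonal, `D = diag(d)` with
`0 ≤ d_i ≤ 1`, and `B = I − D + DA`, then (1) `b_{ii} > 0`; (2) `B` is `SDD₁`;
(3) `N₁(B) ⊆ N₁(A)` and `N₂(A) ⊆ N₂(B)`; (4) `B` is an `N₂(A)`-`SDD₁` matrix. -/
theorem stmt14 {n : ℕ} (hn : 2 ≤ n) (A : Matrix (Fin n) (Fin n) ℝ) (hA : IsSDD1R A)
    (hpos : ∀ i, 0 < A i i) (d : Fin n → ℝ) (hd : ∀ i, 0 ≤ d i ∧ d i ≤ 1)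
    (B : Matrix (Fin n) (Fin n) ℝ)
    (hB : B = 1 - Matrix.diagonal d + Matrix.diagonal d * A) :
    (∀ i, 0 < B i i) ∧
      IsSDD1R B ∧
      setN1R B ⊆ setN1R A ∧
      setN2R A ⊆ setN2R B ∧
      ∀ i, 0 < |B i i| - rowRSR B ((setN2R A)ᶜ) i - rowQSR B (setN2R A) i := by
  have hdiag : ∀ i, B i i = 1 - d i + d i * A i i := fun i => by
    simp [hB, Matrix.diagonal_mul]
  have hoff : ∀ i j, j ≠ i → |B i j| = d i * |A i j| := fun i j hji => by
    simp [hB, Matrix.diagonal_mul, Matrix.one_apply_ne hji.symm,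
      Matrix.diagonal_apply_ne _ hji.symm, abs_mul, abs_of_nonneg (hd i).1]
  have hrow : ∀ i, rowRR B i = d i * rowRR A i := fun i => by
    rw [rowRR, rowRR, Finset.mul_sum]
    exact Finset.sum_congr rfl fun j hj => hoff i j (Finset.ne_of_mem_erase hj)
  have hlt : ∀ i r, r < A i i → d i * r < B i i := fun i r hr => by
    rw [hdiag]
    rcases (hd i).1.eq_or_lt with h | h
    · simp [← h]
    · nlinarith [(hd i).2, mul_lt_mul_of_pos_left hr h]
  have hBpos : ∀ i, 0 < B i i := fun i => by simpa using hlt i 0 (hpos i)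
  have hN₂ : setN2R A ⊆ setN2R B := fun i hi => by
    have hi' : rowRR A i < A i i := by simpa [setN2R, abs_of_pos (hpos i)] using hi
    simpa [setN2R, abs_of_pos (hBpos i), hrow] using hlt i _ hi'
  have hratio : ∀ j, rowRR B j / |B j j| ≤ rowRR A j / |A j j| := fun j => by
    rw [abs_of_pos (hBpos j), abs_of_pos (hpos j), div_le_div_iff₀ (hBpos j) (hpos j), hrow, hdiag]
    nlinarith [mul_nonneg (rowRR_nonneg A j) (sub_nonneg.2 (hd j).2)]
  have hS : ∀ i, rowRSR B (setN2R A)ᶜ i + rowQSR B (setN2R A) i < |B i i| := fun i => by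
    have hP := hA i
    rw [PfunR, setN1R_eq_compl, abs_of_pos (hpos i)] at hP
    rw [abs_of_pos (hBpos i)]
    refine lt_of_le_of_lt ?_ (hlt i _ hP)
    rw [rowRSR_compl_add_rowQSR, rowRSR_compl_add_rowQSR, Finset.mul_sum]
    refine Finset.sum_le_sum fun j hj => ?_
    rw [hoff i j (Finset.ne_of_mem_erase hj), mul_assoc]
    refine mul_le_mul_of_nonneg_left (mul_le_mul_of_nonneg_left ?_ (abs_nonneg _)) (hd i).1
    split_ifs
    · exact hratio j
    · exact le_rfl
  refine ⟨hBpos, fun i => ?_, ?_, hN₂, fun i => by linarith [hS i]⟩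
  · rw [PfunR, setN1R_eq_compl]
    exact (rowRSR_compl_add_rowQSR_anti B hN₂ subset_rfl i).trans_lt (hS i)
  · rw [setN1R_eq_compl, setN1R_eq_compl]
    exact Finset.compl_subset_compl.2 hN₂
end

section
/- Let M = (m_{ij}) ∈ ℝ^{n×n} be a B₁-matrix that is also a Z-matrix (m_{ij} ≤ 0 for all i ≠ j, so that r_i = 0 for all i and M = A is an SDD₁ matrix with positive diagonal entries), and suppose N₁(A) is nonempty and |N₂(A)| ≥ 2. Then for every diagonal matrix D = diag(d₁,…,d_n) with 0 ≤ d_i ≤ 1 for all i, the matrix I − D + DM is nonsingular and ‖(I − D + DM)⁻¹‖_∞ ≤ (1 + max_{i∈N₂(A)} P_i(A)/a_{ii}) · max{φ̃, ψ̃}, where φ̃ = max_{i,j∈N₂(A), i≠j} ( max{1, a_{jj}} + R_i^{N₂(A)}(A) ) / min{1, a_{ii}, a_{jj}, a_{ii}a_{jj} − R_i^{N₂(A)}(A)R_j^{N₂(A)}(A)} and ψ̃ = max_{i∈N₁(A)} (1 + φ̃·R_i^{N₂(A)}(A)) / min{1, a_{ii} − R_i^{N₁(A)}(A) − Σ_{j∈N₂(A)}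 (|a_{ij}|/a_{jj})·P_j(A)}. -/
open Finset Matrix
open scoped BigOperators Classical

/-- Maximum absolute row sum (the `ℓ∞`-operator norm) of a real matrix. -/
noncomputable def infNormR {p q : Type*} [Fintype p] [Fintype q] (B : Matrix p q ℝ) : ℝ :=
  ⨆ i, ∑ j, |B i j|

/-- `r_i = max{0, max_{j≠i} m_{ij}}`. -/
noncomputable def rOf {n : ℕ} (M : Matrix (Fin n) (Fin n) ℝ) (i : Fin n) : ℝ :=
  max 0 (⨆ j : {j : Fin n // j ≠ i}, M i (j : Fin n))

/-- The matrix `A = (m_{ij} − r_i)` in the decomposition `M = A + C` of a `B₁`-matrix. -/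
noncomputable def matA {n : ℕ} (M : Matrix (Fin n) (Fin n) ℝ) : Matrix (Fin n) (Fin n) ℝ :=
  fun i j => M i j - rOf M i

/-- `φ̃ = max_{i,j∈N₂(A), i≠j} (max{1,a_{jj}} + R_i^{N₂}(A)) /
min{1, a_{ii}, a_{jj}, a_{ii}a_{jj} − R_i^{N₂}(A)R_j^{N₂}(A)}`. -/
noncomputable def phiT {n : ℕ} (A : Matrix (Fin n) (Fin n) ℝ) : ℝ :=
  ⨆ p : {p : Fin n × Fin n // p.1 ∈ setN2R A ∧ p.2 ∈ setN2R A ∧ p.1 ≠ p.2},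
    (max 1 (A p.1.2 p.1.2) + rowRSR A (setN2R A) p.1.1) /
      min (min 1 (A p.1.1 p.1.1))
        (min (A p.1.2 p.1.2)
          (A p.1.1 p.1.1 * A p.1.2 p.1.2 -
            rowRSR A (setN2R A) p.1.1 * rowRSR A (setN2R A) p.1.2))

/-- `ψ̃ = max_{i∈N₁(A)} (1 + φ̃·R_i^{N₂}(A)) /
min{1, a_{ii} − R_i^{N₁}(A) − Σ_{j∈N₂}(|a_{ij}|/a_{jj})P_j(A)}`. -/
noncomputable def psiT {n : ℕ} (A : Matrix (Fin n) (Fin n) ℝ) : ℝ :=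
  ⨆ i : ↥(setN1R A),
    (1 + phiT A * rowRSR A (setN2R A) (i : Fin n)) /
      min 1 (A (i : Fin n) (i : Fin n) - rowRSR A (setN1R A) (i : Fin n) -
        ∑ j ∈ setN2R A, |A (i : Fin n) j| / A j j * PfunR A j)

/-- A matrix whose solutions with data bounded by `1` are bounded by `K` is nonsingular, with
inverse of row-sum norm at most `K`. -/
theorem det_ne_zero_and_infNormR_inv_le {m : Type*} [Fintype m] [DecidableEq m] [Nonempty m]
    (B : Matrix m m ℝ) (K : ℝ)
    (h : ∀ x : m → ℝ, (∀ i, |(B *ᵥ x) i| ≤ 1) → ∀ i, |x i| ≤ K) :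
    B.det ≠ 0 ∧ infNormR B⁻¹ ≤ K := by
  have hdet : B.det ≠ 0 := by
    intro h0
    obtain ⟨v, hv, hBv⟩ := Matrix.exists_mulVec_eq_zero_iff.mpr h0
    obtain ⟨i, hi⟩ := Function.ne_iff.mp hv
    have hi' : |v i| ≠ 0 := abs_ne_zero.mpr hi
    have h1 := h (((K + 1) / |v i|) • v) (by simp [Matrix.mulVec_smul, hBv]) i
    rw [Pi.smul_apply, smul_eq_mul, abs_mul, abs_div, abs_abs, div_mul_cancel₀ _ hi'] at h1
    linarith [le_abs_self (K + 1)]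
  refine ⟨hdet, ciSup_le fun i => ?_⟩
  set s : m → ℝ := fun j => SignType.sign (B⁻¹ i j) with hs
  have hBs : B *ᵥ (B⁻¹ *ᵥ s) = s := by
    rw [Matrix.mulVec_mulVec, Matrix.mul_nonsing_inv _ (isUnit_iff_ne_zero.mpr hdet),
      Matrix.one_mulVec]
  have h1 := h (B⁻¹ *ᵥ s) (fun j => by
    rw [hBs]
    rcases lt_trichotomy (B⁻¹ i j) 0 with hj | hj | hj <;> simp [hs, hj]) i
  have h2 : (B⁻¹ *ᵥ s) i = ∑ j, |B⁻¹ i j| :=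
    Finset.sum_congr rfl fun j _ => self_mul_sign _
  rw [← h2]
  exact (le_abs_self _).trans h1

/-- Comparison principle for strictly diagonally dominant systems of inequalities. -/
theorem abs_le_of_dominant {m : Type*} [DecidableEq m] (T : Finset m) (e : m → m → ℝ)
    (b g w c : m → ℝ) (he : ∀ i ∈ T, ∀ j, 0 ≤ e i j)
    (hb : ∀ i ∈ T, ∑ j ∈ T.erase i, e i j < b i)
    (hw : ∀ i ∈ T, b i * |w i| ≤ g i + ∑ j ∈ T.erase i, e i j * |w j|)
    (hc : ∀ i ∈ T, g i + ∑ j ∈ T.erase i, e i j * c j ≤ b i * c i) :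
    ∀ i ∈ T, |w i| ≤ c i := by
  intro k hk
  obtain ⟨i, hi, hmax⟩ := T.exists_max_image (fun i => |w i| - c i) ⟨k, hk⟩
  suffices |w i| - c i ≤ 0 by linarith [hmax k hk]
  by_contra! hpos
  have h1 : ∑ j ∈ T.erase i, e i j * |w j| ≤
      ∑ j ∈ T.erase i, e i j * c j + (∑ j ∈ T.erase i, e i j) * (|w i| - c i) := by
    rw [Finset.sum_mul, ← Finset.sum_add_distrib]
    refine Finset.sum_le_sum fun j hj => ?_
    have := hmax j (Finset.mem_of_mem_erase hj)
    nlinarith [he i hi j]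
  nlinarith [hw i hi, hc i hi, mul_lt_mul_of_pos_right (hb i hi) hpos]

/-- Moving the off-diagonal part of row `i` of `I - D + DA` to the right-hand side. -/
theorem diag_mul_abs_le {m : Type*} [DecidableEq m] {A : Matrix m m ℝ} {T : Finset m} {i : m}
    (hi : i ∈ T) {δ z : ℝ} (h0 : 0 ≤ δ) (h1 : δ ≤ 1) (ha : 0 < A i i) {x : m → ℝ}
    (h : (1 - δ) * x i + δ * ∑ j ∈ T, A i j * x j = z) :
    (1 - δ + δ * A i i) * |x i| ≤ |z| + ∑ j ∈ T.erase i, δ * |A i j| * |x j| := by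
  have hb : 0 ≤ 1 - δ + δ * A i i := by nlinarith
  have h2 : (1 - δ + δ * A i i) * x i = z - ∑ j ∈ T.erase i, δ * A i j * x j := by
    rw [← h, ← Finset.add_sum_erase _ _ hi]
    simp only [mul_assoc, ← Finset.mul_sum]
    ring
  calc (1 - δ + δ * A i i) * |x i| = |z - ∑ j ∈ T.erase i, δ * A i j * x j| := by
        rw [← h2, abs_mul, abs_of_nonneg hb]
    _ ≤ |z| + |∑ j ∈ T.erase i, δ * A i j * x j| := abs_sub _ _
    _ ≤ _ := by
        gcongr
        refine (Finset.abs_sum_le_sum_abs _ _).trans_eq (Finset.sum_congr rfl fun j _ => ?_)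
        rw [abs_mul, abs_mul, abs_of_nonneg h0]

theorem one_sub_diagonal_add_mulVec {m : Type*} [Fintype m] [DecidableEq m] (A : Matrix m m ℝ)
    (d x : m → ℝ) (i : m) :
    ((1 - Matrix.diagonal d + Matrix.diagonal d * A) *ᵥ x) i =
      (1 - d i) * x i + d i * ∑ j, A i j * x j := by
  rw [Matrix.add_mulVec, Matrix.sub_mulVec, ← Matrix.mulVec_mulVec]
  simp only [Pi.add_apply, Pi.sub_apply, Matrix.one_mulVec, Matrix.mulVec_diagonal]
  simp only [Matrix.mulVec, dotProduct]
  ring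

theorem matA_eq_self {n : ℕ} {M : Matrix (Fin n) (Fin n) ℝ} (hZ : ∀ i j, i ≠ j → M i j ≤ 0) :
    matA M = M := by
  ext i j
  have : rOf M i = 0 := max_eq_left (Real.iSup_nonpos fun j => hZ i j j.2.symm)
  rw [matA, this, sub_zero]

section Rows

variable {m : Type*} [Fintype m] [DecidableEq m] {A : Matrix m m ℝ}

theorem rowRSR_nonneg (S : Finset m) (i : m) : 0 ≤ rowRSR A S i :=
  Finset.sum_nonneg fun _ _ => abs_nonneg _

theorem sum_setN1R_add_sum_setN2R (f : m → ℝ) :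
    ∑ j ∈ setN1R A, f j + ∑ j ∈ setN2R A, f j = ∑ j, f j := by
  have : setN2R A = Finset.univ.filter fun i => ¬ |A i i| ≤ rowRR A i := by
    ext i; simp [setN2R]
  rw [this, setN1R, Finset.sum_filter_add_sum_filter_not]

theorem mem_setN1R_or_mem_setN2R (i : m) : i ∈ setN1R A ∨ i ∈ setN2R A := by
  simpa [setN1R, setN2R] using le_or_gt _ _

theorem notMem_setN2R_iff (i : m) : i ∉ setN2R A ↔ i ∈ setN1R A := by
  simp [setN1R, setN2R]

theorem rowRSR_add_rowRSR (i : m) :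
    rowRSR A (setN1R A) i + rowRSR A (setN2R A) i = rowRR A i := by
  have h := sum_setN1R_add_sum_setN2R (A := A) fun j => if j = i then 0 else |A i j|
  have key : ∀ S : Finset m, ∑ j ∈ S, (if j = i then 0 else |A i j|) =
      ∑ j ∈ S.erase i, |A i j| := by
    intro S
    rw [← Finset.filter_ne', Finset.sum_filter]
    exact Finset.sum_congr rfl fun j _ => by by_cases hj : j = i <;> simp [hj]
  simpa only [key, rowRSR, rowRR] using h

theorem PfunR_nonneg (i : m) : 0 ≤ PfunR A i :=
  add_nonneg (rowRSR_nonneg _ _) <| Finset.sum_nonneg fun _ _ =>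
    div_nonneg (mul_nonneg (abs_nonneg _) (Finset.sum_nonneg fun _ _ => abs_nonneg _))
      (abs_nonneg _)

theorem rowRSR_setN2R_lt (hpos : ∀ i, 0 < A i i) {i : m} (hi : i ∈ setN2R A) :
    rowRSR A (setN2R A) i < A i i := by
  have h1 : rowRR A i < |A i i| := (Finset.mem_filter.mp hi).2
  rw [abs_of_pos (hpos i)] at h1
  linarith [rowRSR_add_rowRSR (A := A) i, rowRSR_nonneg (A := A) (setN1R A) i]

theorem PfunR_le_rowRR (i : m) : PfunR A i ≤ rowRR A i := by
  rw [← rowRSR_add_rowRSR, PfunR]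
  gcongr
  refine Finset.sum_le_sum fun j hj => ?_
  have h1 : rowRR A j < |A j j| := (Finset.mem_filter.mp (Finset.mem_of_mem_erase hj)).2
  rw [mul_div_assoc]
  exact mul_le_of_le_one_right (abs_nonneg _) (div_le_one_of_le₀ h1.le (abs_nonneg _))

theorem rowRSR_add_sum_le_PfunR (hpos : ∀ i, 0 < A i i) (i : m) :
    rowRSR A (setN1R A) i + ∑ j ∈ (setN2R A).erase i, |A i j| * (PfunR A j / A j j) ≤
      PfunR A i := by
  rw [PfunR]
  gcongr
  refine Finset.sum_le_sum fun j _ => ?_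
  rw [abs_of_pos (hpos j), mul_div_assoc]
  have := hpos j
  gcongr
  exact PfunR_le_rowRR j

end Rows

section Bounds

variable {n : ℕ} {A : Matrix (Fin n) (Fin n) ℝ} {d : Fin n → ℝ}

theorem diag_pos (hpos : ∀ i, 0 < A i i) (hd : ∀ i, 0 ≤ d i ∧ d i ≤ 1) (i : Fin n) :
    0 < 1 - d i + d i * A i i := by
  obtain ⟨h0, h1⟩ := hd i
  rcases h0.eq_or_lt with h | h
  · simp [← h]
  · nlinarith [mul_pos h (hpos i)]

theorem sum_lt_diag (hpos : ∀ i, 0 < A i i) (hd : ∀ i, 0 ≤ d i ∧ d i ≤ 1) :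
    ∀ i ∈ setN2R A, ∑ j ∈ (setN2R A).erase i, d i * |A i j| < 1 - d i + d i * A i i := by
  intro i hi
  rw [← Finset.mul_sum]
  have h := rowRSR_setN2R_lt hpos hi
  rw [rowRSR] at h
  obtain ⟨h0, h1⟩ := hd i
  rcases h0.eq_or_lt with h' | h'
  · simp [← h']
  · nlinarith

theorem exists_solution_setN2R (hpos : ∀ i, 0 < A i i) (hd : ∀ i, 0 ≤ d i ∧ d i ≤ 1)
    (y : Fin n → ℝ) :
    ∃ t : Fin n → ℝ, (∀ i ∈ setN1R A, t i = 0) ∧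
      ∀ i ∈ setN2R A, (1 - d i) * t i + d i * ∑ j ∈ setN2R A, A i j * t j = y i := by
  set d' : Fin n → ℝ := fun i => if i ∈ setN2R A then d i else 0 with hd'
  set B := 1 - Matrix.diagonal d' + Matrix.diagonal d' * A with hB
  have row1 : ∀ x : Fin n → ℝ, ∀ i ∈ setN1R A, (B *ᵥ x) i = x i := by
    intro x i hi
    rw [hB, one_sub_diagonal_add_mulVec]
    simp [hd', (notMem_setN2R_iff i).mpr hi]
  have row2 : ∀ x : Fin n → ℝ, (∀ i ∈ setN1R A, x i = 0) → ∀ i ∈ setN2R A,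
      (B *ᵥ x) i = (1 - d i) * x i + d i * ∑ j ∈ setN2R A, A i j * x j := by
    intro x hx i hi
    rw [hB, one_sub_diagonal_add_mulVec, ← sum_setN1R_add_sum_setN2R (A := A),
      Finset.sum_eq_zero (s := setN1R A) fun j hj => by rw [hx j hj, mul_zero]]
    simp [hd', hi]
  have hdet : B.det ≠ 0 := by
    intro h0
    obtain ⟨v, hv, hBv⟩ := Matrix.exists_mulVec_eq_zero_iff.mpr h0
    have hv1 : ∀ i ∈ setN1R A, v i = 0 := fun i hi => by rw [← row1 v i hi, hBv]; rfl
    have hv2 := abs_le_of_dominant (setN2R A) (fun i j => d i * |A i j|)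
      (fun i => 1 - d i + d i * A i i) 0 v 0
      (fun i _ j => mul_nonneg (hd i).1 (abs_nonneg _)) (sum_lt_diag hpos hd)
      (fun i hi => by
        have := diag_mul_abs_le hi (hd i).1 (hd i).2 (hpos i) (row2 v hv1 i hi).symm
        simpa [hBv] using this) (by simp)
    refine hv (funext fun i => ?_)
    rcases mem_setN1R_or_mem_setN2R (A := A) i with hi | hi
    · exact hv1 i hi
    · exact abs_nonpos_iff.mp (hv2 i hi)
  set y' : Fin n → ℝ := fun i => if i ∈ setN2R A then y i else 0 with hy'
  have ht : B *ᵥ (B⁻¹ *ᵥ y') = y' := by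
    rw [Matrix.mulVec_mulVec, Matrix.mul_nonsing_inv _ (isUnit_iff_ne_zero.mpr hdet),
      Matrix.one_mulVec]
  have ht1 : ∀ i ∈ setN1R A, (B⁻¹ *ᵥ y') i = 0 := fun i hi => by
    rw [← row1 (B⁻¹ *ᵥ y') i hi, ht]
    simp [hy', (notMem_setN2R_iff i).mpr hi]
  refine ⟨B⁻¹ *ᵥ y', ht1, fun i hi => ?_⟩
  rw [← row2 (B⁻¹ *ᵥ y') ht1 i hi, ht]
  simp [hy', hi]

theorem abs_le_phiT (hpos : ∀ i, 0 < A i i) (hd : ∀ i, 0 ≤ d i ∧ d i ≤ 1)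
    (hN2 : 2 ≤ (setN2R A).card) {t y : Fin n → ℝ} (hy : ∀ i, |y i| ≤ 1)
    (ht : ∀ i ∈ setN2R A, (1 - d i) * t i + d i * ∑ j ∈ setN2R A, A i j * t j = y i) :
    ∀ i ∈ setN2R A, |t i| ≤ phiT A := by
  intro k hk
  obtain ⟨p, hp, hpmax⟩ := (setN2R A).exists_max_image (fun i => |t i|) ⟨k, hk⟩
  have hne : ((setN2R A).erase p).Nonempty := by
    rw [← Finset.card_pos, Finset.card_erase_of_mem hp]; omega
  obtain ⟨q, hq, hqmax⟩ := ((setN2R A).erase p).exists_max_image (fun i => |t i|) hne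
  obtain ⟨hqp, hq2⟩ := Finset.mem_erase.mp hq
  refine (hpmax k hk).trans ?_
  refine le_trans ?_ (le_ciSup (Set.finite_range _).bddAbove
    (⟨(p, q), hp, hq2, hqp.symm⟩ :
      {p : Fin n × Fin n // p.1 ∈ setN2R A ∧ p.2 ∈ setN2R A ∧ p.1 ≠ p.2}))
  have est : ∀ i ∈ setN2R A, ∀ s, (∀ j ∈ (setN2R A).erase i, |t j| ≤ s) →
      (1 - d i + d i * A i i) * |t i| ≤ 1 + d i * rowRSR A (setN2R A) i * s := by
    intro i hi s hs
    refine (diag_mul_abs_le hi (hd i).1 (hd i).2 (hpos i) (ht i hi)).trans ?_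
    refine add_le_add (hy i) ?_
    rw [rowRSR, Finset.mul_sum, Finset.sum_mul]
    refine Finset.sum_le_sum fun j hj => ?_
    exact mul_le_mul_of_nonneg_left (hs j hj) (mul_nonneg (hd i).1 (abs_nonneg _))
  have hp1 := est p hp _ hqmax
  have hq1 := est q hq2 _ fun j hj => hpmax j (Finset.mem_of_mem_erase hj)
  have hrp := rowRSR_setN2R_lt hpos hp
  have hrq := rowRSR_setN2R_lt hpos hq2
  have hrp0 := rowRSR_nonneg (A := A) (setN2R A) p
  have hrq0 := rowRSR_nonneg (A := A) (setN2R A) q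
  have hbq := diag_pos hpos hd q
  obtain ⟨hp0, hp1'⟩ := hd p
  obtain ⟨hq0, hq1'⟩ := hd q
  have hap := hpos p
  have haq := hpos q
  dsimp only
  generalize rowRSR A (setN2R A) p = r at *
  generalize rowRSR A (setN2R A) q = s at *
  generalize A p p = a at *
  generalize A q q = b at *
  generalize d p = u at *
  generalize d q = v at *
  have hprod : 0 < a * b - r * s := by nlinarith
  set μ := min (min 1 a) (min b (a * b - r * s)) with hμ
  have hμ0 : 0 < μ := by simp [hμ, hap, haq, hprod]
  have m1 : μ ≤ 1 := (min_le_left _ _).trans (min_le_left _ _)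
  have m2 : μ ≤ a := (min_le_left _ _).trans (min_le_right _ _)
  have m3 : μ ≤ b := (min_le_right _ _).trans (min_le_left _ _)
  have m4 : μ ≤ a * b - r * s := (min_le_right _ _).trans (min_le_right _ _)
  have hu : 0 ≤ 1 - u := by linarith
  have hv : 0 ≤ 1 - v := by linarith
  have hden : μ ≤ (1 - u + u * a) * (1 - v + v * b) - u * v * (r * s) := by
    have e1 := mul_le_mul_of_nonneg_left m1 (mul_nonneg hu hv)
    have e2 := mul_le_mul_of_nonneg_left m2 (mul_nonneg hp0 hv)
    have e3 := mul_le_mul_of_nonneg_left m3 (mul_nonneg hu hq0)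
    have e4 := mul_le_mul_of_nonneg_left m4 (mul_nonneg hp0 hq0)
    linarith
  have hnum : 1 - v + v * b + u * r ≤ max 1 b + r := by
    have e1 := mul_le_mul_of_nonneg_left (le_max_left 1 b) hv
    have e2 := mul_le_mul_of_nonneg_left (le_max_right 1 b) hq0
    have e3 := mul_le_mul_of_nonneg_right hp1' hrp0
    linarith
  rw [le_div_iff₀ hμ0]
  have f1 := mul_le_mul_of_nonneg_left hp1 hbq.le
  have f2 := mul_le_mul_of_nonneg_left hq1 (mul_nonneg hp0 hrp0)
  have f3 := mul_le_mul_of_nonneg_left hden (abs_nonneg (t p))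
  linarith

theorem abs_le_PfunR_div_mul (hpos : ∀ i, 0 < A i i) (hd : ∀ i, 0 ≤ d i ∧ d i ≤ 1)
    {w : Fin n → ℝ} {U : ℝ} (hU0 : 0 ≤ U) (hU : ∀ i ∈ setN1R A, |w i| ≤ U)
    (hw : ∀ i ∈ setN2R A, (1 - d i) * w i + d i * ∑ j, A i j * w j = 0) :
    ∀ i ∈ setN2R A, |w i| ≤ PfunR A i / A i i * U := by
  refine abs_le_of_dominant (setN2R A) (fun i j => d i * |A i j|)
    (fun i => 1 - d i + d i * A i i) (fun i => d i * rowRSR A (setN1R A) i * U) w _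
    (fun i _ j => mul_nonneg (hd i).1 (abs_nonneg _)) (sum_lt_diag hpos hd) ?_ ?_
  · intro i hi
    have hi1 : i ∉ setN1R A := fun h => (notMem_setN2R_iff i).mpr h hi
    have heq := hw i hi
    rw [← sum_setN1R_add_sum_setN2R (A := A)] at heq
    have := diag_mul_abs_le (z := -(d i * ∑ j ∈ setN1R A, A i j * w j)) hi (hd i).1 (hd i).2
      (hpos i) (by linarith : (1 - d i) * w i + d i * ∑ j ∈ setN2R A, A i j * w j = _)
    refine this.trans (add_le_add_left ?_ _)
    rw [abs_neg, abs_mul, abs_of_nonneg (hd i).1, mul_assoc]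
    refine mul_le_mul_of_nonneg_left ?_ (hd i).1
    rw [rowRSR, Finset.erase_eq_of_notMem hi1, Finset.sum_mul]
    refine (Finset.abs_sum_le_sum_abs _ _).trans (Finset.sum_le_sum fun j hj => ?_)
    rw [abs_mul]
    exact mul_le_mul_of_nonneg_left (hU j hj) (abs_nonneg _)
  · intro i hi
    have h1 := rowRSR_add_sum_le_PfunR hpos i
    have h2 : ∑ j ∈ (setN2R A).erase i, d i * |A i j| * (PfunR A j / A j j * U) =
        d i * U * ∑ j ∈ (setN2R A).erase i, |A i j| * (PfunR A j / A j j) := by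
      rw [Finset.mul_sum]
      exact Finset.sum_congr rfl fun j _ => by ring
    have h3 : (1 - d i + d i * A i i) * (PfunR A i / A i i * U) =
        (1 - d i) * (PfunR A i / A i i * U) + d i * U * PfunR A i := by
      have := (hpos i).ne'
      field_simp
    have h4 : 0 ≤ (1 - d i) * (PfunR A i / A i i * U) :=
      mul_nonneg (by linarith [(hd i).2])
        (mul_nonneg (div_nonneg (PfunR_nonneg i) (hpos i).le) hU0)
    rw [h2, h3]
    nlinarith [mul_le_mul_of_nonneg_left h1 (mul_nonneg (hd i).1 hU0)]

theorem abs_le_psiT (hSDD1 : IsSDD1R A) (hpos : ∀ i, 0 < A i i)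
    (hd : ∀ i, 0 ≤ d i ∧ d i ≤ 1) (hN1 : (setN1R A).Nonempty)
    {t w y : Fin n → ℝ} (hy : ∀ i, |y i| ≤ 1) (hφ : 0 ≤ phiT A)
    (ht : ∀ i ∈ setN2R A, |t i| ≤ phiT A)
    (hw2 : ∀ i ∈ setN2R A, (1 - d i) * w i + d i * ∑ j, A i j * w j = 0)
    (hw1 : ∀ i ∈ setN1R A, (1 - d i) * w i +
      d i * (∑ j, A i j * w j + ∑ j ∈ setN2R A, A i j * t j) = y i) :
    ∀ i ∈ setN1R A, |w i| ≤ psiT A := by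
  intro k hk
  obtain ⟨i, hi, hmax⟩ := (setN1R A).exists_max_image (fun i => |w i|) hN1
  refine (hmax k hk).trans (le_trans ?_ (le_ciSup (Set.finite_range _).bddAbove
    (⟨i, hi⟩ : ↥(setN1R A))))
  have hw := abs_le_PfunR_div_mul hpos hd (abs_nonneg (w i)) hmax hw2
  have hi2 : i ∉ setN2R A := (notMem_setN2R_iff i).mpr hi
  have hP : ∑ j ∈ setN2R A, |A i j| / A j j * PfunR A j =
      ∑ j ∈ (setN2R A).erase i, |A i j| * (PfunR A j / A j j) := by
    rw [Finset.erase_eq_of_notMem hi2]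
    exact Finset.sum_congr rfl fun j _ => by ring
  have heq := hw1 i hi
  rw [← sum_setN1R_add_sum_setN2R (A := A)] at heq
  have h1 := diag_mul_abs_le
    (z := y i - d i * (∑ j ∈ setN2R A, A i j * w j + ∑ j ∈ setN2R A, A i j * t j)) hi
    (hd i).1 (hd i).2 (hpos i)
    (by linarith : (1 - d i) * w i + d i * ∑ j ∈ setN1R A, A i j * w j = _)
  have h2 : |∑ j ∈ setN2R A, A i j * t j| ≤ phiT A * rowRSR A (setN2R A) i := by
    rw [rowRSR, Finset.erase_eq_of_notMem hi2, Finset.mul_sum]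
    refine (Finset.abs_sum_le_sum_abs _ _).trans (Finset.sum_le_sum fun j hj => ?_)
    rw [abs_mul, mul_comm]
    exact mul_le_mul_of_nonneg_right (ht j hj) (abs_nonneg _)
  have h3 : |∑ j ∈ setN2R A, A i j * w j| ≤
      (∑ j ∈ setN2R A, |A i j| / A j j * PfunR A j) * |w i| := by
    rw [Finset.sum_mul]
    refine (Finset.abs_sum_le_sum_abs _ _).trans (Finset.sum_le_sum fun j hj => ?_)
    rw [abs_mul]
    refine (mul_le_mul_of_nonneg_left (hw j hj) (abs_nonneg _)).trans_eq (by ring)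
  have h4 : ∑ j ∈ (setN1R A).erase i, d i * |A i j| * |w j| ≤
      d i * rowRSR A (setN1R A) i * |w i| := by
    rw [rowRSR, Finset.mul_sum, Finset.sum_mul]
    refine Finset.sum_le_sum fun j hj => ?_
    exact mul_le_mul_of_nonneg_left (hmax j (Finset.mem_of_mem_erase hj))
      (mul_nonneg (hd i).1 (abs_nonneg _))
  have h5 : |y i - d i * (∑ j ∈ setN2R A, A i j * w j + ∑ j ∈ setN2R A, A i j * t j)| ≤
      1 + d i * ((∑ j ∈ setN2R A, |A i j| / A j j * PfunR A j) * |w i| +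
        phiT A * rowRSR A (setN2R A) i) := by
    refine (abs_sub _ _).trans (add_le_add (hy i) ?_)
    rw [abs_mul, abs_of_nonneg (hd i).1]
    exact mul_le_mul_of_nonneg_left ((abs_add_le _ _).trans (add_le_add h3 h2)) (hd i).1
  have h6 := rowRSR_add_sum_le_PfunR hpos i
  rw [← hP] at h6
  have h7 := hSDD1 i
  rw [abs_of_pos (hpos i)] at h7
  have h8 := rowRSR_nonneg (A := A) (setN2R A) i
  obtain ⟨hd0, hd1⟩ := hd i
  dsimp only
  generalize ∑ j ∈ setN2R A, |A i j| / A j j * PfunR A j = p at *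
  set μ := min 1 (A i i - rowRSR A (setN1R A) i - p) with hμ
  have hμ0 : 0 < μ := lt_min one_pos (by linarith)
  rw [le_div_iff₀ hμ0]
  have g1 := mul_le_mul_of_nonneg_left (min_le_left 1 (A i i - rowRSR A (setN1R A) i - p))
    (sub_nonneg.mpr hd1)
  have g2 := mul_le_mul_of_nonneg_left (min_le_right 1 (A i i - rowRSR A (setN1R A) i - p)) hd0
  rw [← hμ] at g1 g2
  have g3 : μ ≤ 1 - d i + d i * (A i i - rowRSR A (setN1R A) i - p) := by linarith
  have g4 := mul_le_mul_of_nonneg_left g3 (abs_nonneg (w i))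
  have g5 := mul_le_mul_of_nonneg_right hd1 (mul_nonneg hφ h8)
  linarith

end Bounds

/-- If `M` is a `B₁`-matrix that is also a `Z`-matrix (so `r_i = 0` and `M = A`),
`N₁(A) ≠ ∅` and `|N₂(A)| ≥ 2`, then for every `D = diag(d)` with `0 ≤ d_i ≤ 1`, the matrix
`I − D + DM` is nonsingular and
`‖(I − D + DM)⁻¹‖_∞ ≤ (1 + max_{i∈N₂(A)} P_i(A)/a_{ii})·max{φ̃, ψ̃}`. -/
theorem stmt16 {n : ℕ} (hn : 2 ≤ n) (M : Matrix (Fin n) (Fin n) ℝ)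
    (hZ : ∀ i j, i ≠ j → M i j ≤ 0)
    (hSDD1 : IsSDD1R (matA M)) (hpos : ∀ i, 0 < matA M i i)
    (hN1 : (setN1R (matA M)).Nonempty) (hN2 : 2 ≤ (setN2R (matA M)).card)
    (d : Fin n → ℝ) (hd : ∀ i, 0 ≤ d i ∧ d i ≤ 1) :
    (1 - Matrix.diagonal d + Matrix.diagonal d * M).det ≠ 0 ∧
      infNormR (1 - Matrix.diagonal d + Matrix.diagonal d * M)⁻¹ ≤
        (1 + ⨆ i : ↥(setN2R (matA M)),
            PfunR (matA M) (i : Fin n) / matA M (i : Fin n) (i : Fin n)) *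
          max (phiT (matA M)) (psiT (matA M)) := by
  rw [matA_eq_self hZ] at hSDD1 hpos hN1 hN2 ⊢
  have : Nonempty (Fin n) := ⟨⟨0, by omega⟩⟩
  refine det_ne_zero_and_infNormR_inv_le _ _ fun x hx => ?_
  obtain ⟨t, ht1, ht2⟩ := exists_solution_setN2R hpos hd
    ((1 - Matrix.diagonal d + Matrix.diagonal d * M) *ᵥ x)
  have htφ := abs_le_phiT hpos hd hN2 hx ht2
  obtain ⟨k, hk⟩ : (setN2R M).Nonempty := Finset.card_pos.mp (by omega)
  have hφ : 0 ≤ phiT M := (abs_nonneg _).trans (htφ k hk)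
  have hsum : ∀ i, ∑ j, M i j * (x - t) j =
      ∑ j, M i j * x j - ∑ j ∈ setN2R M, M i j * t j := by
    intro i
    have h1 : ∑ j, M i j * t j = ∑ j ∈ setN2R M, M i j * t j := by
      rw [← sum_setN1R_add_sum_setN2R (A := M),
        Finset.sum_eq_zero (s := setN1R M) fun j hj => by rw [ht1 j hj, mul_zero], zero_add]
    rw [← h1, ← Finset.sum_sub_distrib]
    exact Finset.sum_congr rfl fun j _ => by rw [Pi.sub_apply]; ring
  have hw2 : ∀ i ∈ setN2R M, (1 - d i) * (x - t) i + d i * ∑ j, M i j * (x - t) j = 0 := by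
    intro i hi
    have h := ht2 i hi
    rw [one_sub_diagonal_add_mulVec] at h
    rw [hsum, Pi.sub_apply]
    linarith
  have hψ := abs_le_psiT hSDD1 hpos hd hN1 hx hφ htφ hw2 fun i hi => by
    rw [one_sub_diagonal_add_mulVec, hsum, Pi.sub_apply, ht1 i hi]
    ring
  set K := max (phiT M) (psiT M) with hK
  have hK0 : 0 ≤ K := hφ.trans (le_max_left _ _)
  have hP : ∀ i ∈ setN2R M, PfunR M i / M i i ≤ ⨆ i : ↥(setN2R M),
      PfunR M (i : Fin n) / M (i : Fin n) (i : Fin n) := fun i hi =>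
    le_ciSup (f := fun i : ↥(setN2R M) => PfunR M (i : Fin n) / M (i : Fin n) (i : Fin n))
      (Set.finite_range _).bddAbove ⟨i, hi⟩
  have hP0 := (div_nonneg (PfunR_nonneg (A := M) k) (hpos k).le).trans (hP k hk)
  intro i
  rcases mem_setN1R_or_mem_setN2R (A := M) i with hi | hi
  · have h := (hψ i hi).trans (le_max_right (phiT M) _)
    rw [Pi.sub_apply, ht1 i hi, sub_zero] at h
    nlinarith [mul_nonneg hP0 hK0]
  · have h := abs_le_PfunR_div_mul hpos hd hK0
      (fun j hj => (hψ j hj).trans (le_max_right _ _)) hw2 i hi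
    have h1 := (htφ i hi).trans (le_max_left _ (psiT M))
    have h2 := abs_add_le ((x - t) i) (t i)
    rw [Pi.sub_apply, sub_add_cancel] at h2
    have h3 := mul_le_mul_of_nonneg_right (hP i hi) hK0
    rw [Pi.sub_apply] at h
    linarith
end
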